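/- Let D be a finite digraph (no multiple arcs) whose loops touch only themselves, sinks and sources. Then i(T^-(D)) = 2v − A − B, where v is the number of vertices of D, A the number of sinks of D and B the number of sources of D. -/

import Mathlib

/-- The type of arcs of a digraph given by a relation `E` on `V`. -/
abbrev Arc (V : Type) (E : V → V → Prop) : Type := {p : V × V // E p.1 p.2}

/-- A sink: a vertex with no outgoing arcs. -/
def IsSink {V : Type} (E : V → V → Prop) (x : V) : Prop := ∀ y, ¬ E x y

/-- A source: a vertex with no incoming arcs. -/
def IsSource {V : Type} (E : V → V → Prop) (x : V) : Prop := ∀ y, ¬ E y x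

/-- The Heuchenne condition. -/
def Heuchenne {V : Type} (E : V → V → Prop) : Prop :=
  ∀ u v w x : V, E v w → E u w → E u x → E v x

/-- The intersection number of a digraph: the least `n` such that the digraph has an
intersection representation by ordered pairs of subsets of a set with `n` elements. -/
noncomputable def iNum {V : Type} (E : V → V → Prop) : ℕ :=
  sInf {n : ℕ | ∃ S T : V → Set (Fin n), ∀ x y : V, E x y ↔ (S x ∩ T y).Nonempty}

/-- The arc relation of the subdivision digraph `S(D)` on `V ⊕ Arc V E`. -/
def SArc {V : Type} (E : V → V → Prop) : V ⊕ Arc V E → V ⊕ Arc V E → Prop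
  | Sum.inl u, Sum.inr e => e.val.1 = u
  | Sum.inr e, Sum.inl w => e.val.2 = w
  | _, _ => False

/-- The arc relation of the middle digraph `M(D)`: arcs of `S(D)` together with the
arcs of the line digraph between arc-vertices. -/
def MArc {V : Type} (E : V → V → Prop) : V ⊕ Arc V E → V ⊕ Arc V E → Prop
  | Sum.inr e, Sum.inr f => e.val.2 = f.val.1
  | a, b => SArc E a b

/-- The arc relation of `N(D)`: arcs of `S(D)` together with the arcs of `D` between
vertex-vertices. -/
def NArc {V : Type} (E : V → V → Prop) : V ⊕ Arc V E → V ⊕ Arc V E → Prop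
  | Sum.inl u, Sum.inl w => E u w
  | a, b => SArc E a b

/-- The arc relation of the total digraph `T(D)`. -/
def TArc {V : Type} (E : V → V → Prop) : V ⊕ Arc V E → V ⊕ Arc V E → Prop
  | Sum.inl u, Sum.inl w => E u w
  | Sum.inl u, Sum.inr e => e.val.1 = u
  | Sum.inr e, Sum.inl w => e.val.2 = w
  | Sum.inr e, Sum.inr f => e.val.2 = f.val.1

/-- The arc relation of `T⁻(D)`: the total digraph with the loops at arc-vertices deleted. -/
def TMinusArc {V : Type} (E : V → V → Prop) (a b : V ⊕ Arc V E) : Prop :=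
  TArc E a b ∧ ∀ e : Arc V E, ¬ (a = Sum.inr e ∧ b = Sum.inr e)

/-- `F` is a cover of the digraph `E` by generalized complete bipartite subdigraphs. -/
def IsGBSCover {V : Type} (E : V → V → Prop) (F : Finset (Set V × Set V)) : Prop :=
  (∀ p ∈ F, ∀ x ∈ p.1, ∀ y ∈ p.2, E x y) ∧
  (∀ x y : V, E x y → ∃ p ∈ F, x ∈ p.1 ∧ y ∈ p.2)

/-- The minimum number of GBSs needed to cover the arcs of the digraph `E`. -/
noncomputable def gbsNum {V : Type} (E : V → V → Prop) : ℕ :=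
  sInf {k : ℕ | ∃ F : Finset (Set V × Set V), F.card = k ∧ IsGBSCover E F}

/-- The loops of `D` touch (other than themselves) only sinks and sources. -/
def LoopsTouchOnlySinksSources {V : Type} (E : V → V → Prop) : Prop :=
  ∀ l : V, E l l → ∀ w : V, w ≠ l → (E w l ∨ E l w) → IsSink E w ∨ IsSource E w

/-- The index set of the optimal representation. -/
abbrev IdxU (V : Type) (E : V → V → Prop) : Type :=
  {x : V // ¬ IsSink E x} ⊕ {x : V // ¬ IsSource E x}

lemma card_IdxU (V : Type) [Fintype V] (E : V → V → Prop) :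
    Nat.card (IdxU V E) =
      2 * Nat.card V - Nat.card {x : V // IsSink E x} - Nat.card {x : V // IsSource E x} := by
  classical
  have h1 := Nat.card_congr (Equiv.sumCompl (fun x : V => IsSink E x))
  have h2 := Nat.card_congr (Equiv.sumCompl (fun x : V => IsSource E x))
  rw [Nat.card_sum] at h1 h2
  rw [Nat.card_sum]
  omega

/-- Out-sets of the representation. -/
def repS {V : Type} (E : V → V → Prop) : V ⊕ Arc V E → IdxU V E → Prop
  | Sum.inl x, Sum.inl u => x = u.1
  | Sum.inr e, Sum.inl u => e.1.2 = u.1 ∧ e.1.1 ≠ u.1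
  | Sum.inl x, Sum.inr w => E x w.1 ∧ (E w.1 w.1 → x = w.1)
  | Sum.inr e, Sum.inr w => e.1.2 = w.1

/-- In-sets of the representation. -/
def repT {V : Type} (E : V → V → Prop) : V ⊕ Arc V E → IdxU V E → Prop
  | Sum.inl x, Sum.inl u => E u.1 x ∧ (IsSource E u.1 ∨ x = u.1)
  | Sum.inr f, Sum.inl u => f.1.1 = u.1
  | Sum.inl x, Sum.inr w => x = w.1
  | Sum.inr f, Sum.inr w => f.1.1 = w.1 ∧ E w.1 w.1 ∧ f.1.2 ≠ w.1

lemma rep_iff {V : Type} (E : V → V → Prop) (hloops : LoopsTouchOnlySinksSources E)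
    (a b : V ⊕ Arc V E) : TMinusArc E a b ↔ ∃ i, repS E a i ∧ repT E b i := by
  constructor
  · rintro ⟨h, hne⟩
    rcases a with u | ⟨⟨p, q⟩, he⟩ <;> rcases b with w | ⟨⟨r, s⟩, hf⟩ <;>
      simp only [TArc] at h
    · by_cases hw : E w w → u = w
      · exact ⟨Sum.inr ⟨w, fun hs => hs u h⟩, ⟨h, hw⟩, rfl⟩
      · push Not at hw
        have hs : IsSource E u :=
          (hloops w hw.1 u hw.2 (Or.inl h)).resolve_left (fun hs => hs w h)
        exact ⟨Sum.inl ⟨u, fun hs => hs w h⟩, rfl, h, Or.inl hs⟩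
    · subst h
      exact ⟨Sum.inl ⟨r, fun hs => hs s hf⟩, rfl, rfl⟩
    · subst h
      exact ⟨Sum.inr ⟨q, fun hs => hs p he⟩, rfl, rfl⟩
    · subst h
      by_cases hp : p = q
      · subst hp
        refine ⟨Sum.inr ⟨p, fun hs => hs p he⟩, rfl, rfl, he, ?_⟩
        intro hs
        simp only at hs
        subst hs
        exact hne _ ⟨rfl, rfl⟩
      · exact ⟨Sum.inl ⟨q, fun hs => hs s hf⟩, ⟨rfl, hp⟩, rfl⟩
  · rintro ⟨i, hS, hT⟩
    rcases a with u | ⟨⟨p, q⟩, he⟩ <;> rcases b with w | ⟨⟨r, s⟩, hf⟩ <;>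
      rcases i with ⟨x, hx⟩ | ⟨x, hx⟩ <;> simp only [repS, repT] at hS hT <;>
      simp only [TMinusArc, TArc] <;> grind [IsSource]

theorem iNum_Tminus
    (V : Type) [Fintype V] (E : V → V → Prop)
    (hloops : LoopsTouchOnlySinksSources E) :
    iNum (TMinusArc E) =
      2 * Nat.card V - Nat.card {x : V // IsSink E x} - Nat.card {x : V // IsSource E x} := by
  classical
  rw [← card_IdxU]
  have hmem : Nat.card (IdxU V E) ∈ {n : ℕ | ∃ S T : V ⊕ Arc V E → Set (Fin n),
      ∀ x y, TMinusArc E x y ↔ (S x ∩ T y).Nonempty} := by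
    let φ := Finite.equivFin (IdxU V E)
    refine ⟨fun a => {i | repS E a (φ.symm i)}, fun a => {i | repT E a (φ.symm i)}, ?_⟩
    intro x y
    rw [rep_iff E hloops]
    constructor
    · rintro ⟨i, h1, h2⟩
      exact ⟨φ i, by simpa using h1, by simpa using h2⟩
    · rintro ⟨i, h1, h2⟩
      exact ⟨φ.symm i, h1, h2⟩
  apply le_antisymm
  · exact Nat.sInf_le hmem
  · refine le_csInf ⟨_, hmem⟩ ?_
    rintro n ⟨S, T, h⟩
    have hout : ∀ u : {x : V // ¬ IsSink E x}, ∃ y, E u.1 y ∧ (E u.1 u.1 → y = u.1) := by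
      rintro ⟨u, hu⟩
      by_cases hl : E u u
      · exact ⟨u, hl, fun _ => rfl⟩
      · simp only [IsSink, not_forall, not_not] at hu
        obtain ⟨y, hy⟩ := hu
        exact ⟨y, hy, fun h => absurd h hl⟩
    have hin : ∀ u : {x : V // ¬ IsSource E x}, ∃ y, E y u.1 ∧ (E u.1 u.1 → y = u.1) := by
      rintro ⟨u, hu⟩
      by_cases hl : E u u
      · exact ⟨u, hl, fun _ => rfl⟩
      · simp only [IsSource, not_forall, not_not] at hu
        obtain ⟨y, hy⟩ := hu
        exact ⟨y, hy, fun h => absurd h hl⟩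
    choose o ho ho' using hout
    choose p hp hp' using hin
    have h1 : ∀ u, (S (Sum.inl u.1) ∩ T (Sum.inr ⟨(u.1, o u), ho u⟩)).Nonempty := fun u =>
      (h _ _).1 ⟨rfl, by simp⟩
    have h2 : ∀ w, (S (Sum.inr ⟨(p w, w.1), hp w⟩) ∩ T (Sum.inl w.1)).Nonempty := fun w =>
      (h _ _).1 ⟨rfl, by simp⟩
    choose f hfS hfT using h1
    choose g hgS hgT using h2
    have cross : ∀ u w, f u ≠ g w := by
      intro u w hfg
      have e1 : E u.1 w.1 := ((h (Sum.inl u.1) (Sum.inl w.1)).2 ⟨f u, hfS u, hfg ▸ hgT w⟩).1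
      have e2 := (h (Sum.inr ⟨(p w, w.1), hp w⟩) (Sum.inr ⟨(u.1, o u), ho u⟩)).2
        ⟨f u, hfg ▸ hgS w, hfT u⟩
      have e3 : w.1 = u.1 := e2.1
      have hl : E u.1 u.1 := e3 ▸ e1
      have hl' : E w.1 w.1 := by rw [e3]; exact hl
      have e4 := ho' u hl
      have e5 := hp' w hl'
      refine e2.2 ⟨(u.1, o u), ho u⟩ ⟨?_, rfl⟩
      congr 2
      rw [e5, e4, e3]
    have hinj : Function.Injective (Sum.elim f g) := by
      rintro (u | w) (u' | w') hh
      · have hh : f u = f u' := hh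
        have := ((h (Sum.inl u.1) (Sum.inr ⟨(u'.1, o u'), ho u'⟩)).2
          ⟨f u, hfS u, hh ▸ hfT u'⟩).1
        exact congrArg _ (Subtype.ext this.symm)
      · exact absurd hh (cross _ _)
      · exact absurd hh.symm (cross _ _)
      · have hh : g w = g w' := hh
        have := ((h (Sum.inr ⟨(p w, w.1), hp w⟩) (Sum.inl w'.1)).2
          ⟨g w, hgS w, hh ▸ hgT w'⟩).1
        exact congrArg _ (Subtype.ext this)
    simpa using Nat.card_le_card_of_injective _ hinj
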